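/- Let (R, m) be a Noetherian local ring and let I be a proper ideal of R. Then ms(R) ≤ ms(R/I) + μ(I). -/

import Mathlib

open IsLocalRing

/-- The minimal number of generators of an ideal. -/
noncomputable def mu {R : Type*} [CommRing R] (I : Ideal R) : ℕ :=
  sInf {n : ℕ | ∃ s : Finset R, s.card = n ∧ Ideal.span (s : Set R) = I}

/-- `ms R = min {μ(I) : m² ⊆ I ⊆ m}`. -/
noncomputable def ms (R : Type*) [CommRing R] [IsLocalRing R] : ℕ :=
  sInf {n : ℕ | ∃ I : Ideal R,
    (maximalIdeal R) ^ 2 ≤ I ∧ I ≤ maximalIdeal R ∧ mu I = n}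

theorem mu_spec' {R : Type*} [CommRing R] [IsNoetherianRing R] (I : Ideal R) :
    ∃ s : Finset R, s.card = mu I ∧ Ideal.span (s : Set R) = I := by
  have h : {n : ℕ | ∃ s : Finset R, s.card = n ∧ Ideal.span (s : Set R) = I}.Nonempty := by
    obtain ⟨s, hs⟩ := (isNoetherianRing_iff_ideal_fg R).mp inferInstance I
    exact ⟨s.card, s, rfl, hs⟩
  exact Nat.sInf_mem h

theorem ms_spec' (R : Type*) [CommRing R] [IsLocalRing R] :
    ∃ I : Ideal R, (maximalIdeal R) ^ 2 ≤ I ∧ I ≤ maximalIdeal R ∧ mu I = ms R := by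
  have h : {n : ℕ | ∃ I : Ideal R,
      (maximalIdeal R) ^ 2 ≤ I ∧ I ≤ maximalIdeal R ∧ mu I = n}.Nonempty :=
    ⟨_, maximalIdeal R, Ideal.pow_le_self two_ne_zero, le_rfl, rfl⟩
  exact Nat.sInf_mem h

theorem ms_aux' {R : Type*} [CommRing R] [IsLocalRing R] [IsNoetherianRing R]
    (I : Ideal R) [IsLocalRing (R ⧸ I)] : ms R ≤ ms (R ⧸ I) + mu I := by
  classical
  obtain ⟨J, hJ1, hJ2, hJ⟩ := ms_spec' (R ⧸ I)
  obtain ⟨s, hs, hsJ⟩ := mu_spec' J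
  obtain ⟨t, ht, htI⟩ := mu_spec' I
  have hloc : IsLocalHom (Ideal.Quotient.mk I) :=
    .of_surjective _ Ideal.Quotient.mk_surjective
  obtain ⟨g, hg⟩ := (Ideal.Quotient.mk_surjective (I := I)).hasRightInverse
  have hspan : Ideal.span ((s.image g ∪ t : Finset R) : Set R) =
      J.comap (Ideal.Quotient.mk I) := by
    have hm : J = (Ideal.span (g '' (s : Set (R ⧸ I)))).map (Ideal.Quotient.mk I) := by
      rw [Ideal.map_span, ← Set.image_comp, ← hsJ]
      congr 1
      have : (Ideal.Quotient.mk I) ∘ g = id := funext hg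
      rw [this, Set.image_id]
    rw [hm, Ideal.comap_map_of_surjective _ Ideal.Quotient.mk_surjective,
      ← RingHom.ker_eq_comap_bot, Ideal.mk_ker, Finset.coe_union, Ideal.span_union, htI,
      Finset.coe_image]
  have h1 : ms R ≤ mu (J.comap (Ideal.Quotient.mk I)) := by
    refine Nat.sInf_le ⟨_, ?_, ?_, rfl⟩
    · rw [← Ideal.map_le_iff_le_comap, Ideal.map_pow]
      exact (Ideal.pow_right_mono (((local_hom_TFAE (Ideal.Quotient.mk I)).out 0 2).mp hloc) 2).trans hJ1
    · intro x hx
      have := hJ2 hx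
      rw [mem_maximalIdeal, mem_nonunits_iff] at this ⊢
      exact fun h => this (h.map _)
  have h2 : mu (J.comap (Ideal.Quotient.mk I)) ≤ (s.image g ∪ t).card :=
    Nat.sInf_le ⟨_, rfl, hspan⟩
  have h3 := Finset.card_union_le (s.image g) t
  have h4 : (s.image g).card ≤ s.card := Finset.card_image_le
  omega

/-- Let `(R, m)` be a Noetherian local ring and `I` a proper ideal of `R`.  Then
`ms(R) ≤ ms(R/I) + μ(I)`. -/
theorem stmt5 {R : Type*} [CommRing R] [IsLocalRing R] [IsNoetherianRing R]
    (I : Ideal R) (hI : I ≠ ⊤) :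
    letI : Nontrivial (R ⧸ I) := Ideal.Quotient.nontrivial_iff.mpr hI
    letI : IsLocalRing (R ⧸ I) :=
      IsLocalRing.of_surjective' (Ideal.Quotient.mk I) Ideal.Quotient.mk_surjective
    ms R ≤ ms (R ⧸ I) + mu I := by
  haveI : Nontrivial (R ⧸ I) := Ideal.Quotient.nontrivial_iff.mpr hI
  haveI : IsLocalRing (R ⧸ I) :=
    IsLocalRing.of_surjective' (Ideal.Quotient.mk I) Ideal.Quotient.mk_surjective
  exact ms_aux' I
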